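/- arXiv:2407.02279 — 8 statements merged into one kernel-verified Lean document; each statement's English description precedes it below -/
import Mathlib

section
/- If F : ℝ → ℝ is convex, then for any z ∈ ℝ, v ≠ 0, and any z′ not belonging to the interval [min(z, z+v), max(z, z+v)], the Bregman Secant distortion is non-negative: B_F^v(z′‖z) ≥ 0. -/
/-- The `v`-derivative of `F` at `z`. -/
noncomputable def vderiv (F : ℝ → ℝ) (v z : ℝ) : ℝ := (F (z + v) - F z) / v

/-- The Bregman Secant distortion with generator `F` and offset `v`. -/
noncomputable def bregSec (F : ℝ → ℝ) (v z' z : ℝ) : ℝ :=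
  F z' - F z - (z' - z) * vderiv F v z

/-- If `F` is convex, then for `z' ∉ [min z (z+v), max z (z+v)]` the Bregman
Secant distortion is non-negative. -/
theorem bregSec_nonneg_of_convex (F : ℝ → ℝ) (hF : ConvexOn ℝ Set.univ F)
    (z v : ℝ) (hv : v ≠ 0) (z' : ℝ)
    (hz' : z' ∉ Set.Icc (min z (z + v)) (max z (z + v))) :
    0 ≤ bregSec F v z' z := by
  have hB : bregSec F v z' z
      = (z' - z) * ((F z' - F z) / (z' - z) - (F (z + v) - F z) / (z + v - z)) := by
    have hz : z' ≠ z := by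
      rintro rfl
      exact hz' ⟨min_le_left _ _, le_max_left _ _⟩
    rw [bregSec, vderiv, add_sub_cancel_left, mul_sub, mul_div_cancel₀ _ (sub_ne_zero.2 hz)]
  have hzv : z + v ≠ z := by simpa using hv
  rw [hB]
  by_cases hmin : min z (z + v) ≤ z'
  · have hmax : max z (z + v) < z' := not_le.1 fun h => hz' ⟨hmin, h⟩
    obtain ⟨h₁, h₂⟩ := max_lt_iff.1 hmax
    exact mul_nonneg (sub_nonneg.2 h₁.le) (sub_nonneg.2
      (hF.secant_mono trivial trivial trivial hzv h₁.ne' h₂.le))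
  · obtain ⟨h₁, h₂⟩ := lt_min_iff.1 (not_le.1 hmin)
    exact mul_nonneg_of_nonpos_of_nonpos (sub_nonpos.2 h₁.le) (sub_nonpos.2
      (hF.secant_mono trivial trivial trivial h₁.ne hzv h₂.le))
end

section
/- If F : ℝ → ℝ is convex, then for any z, z′ ∈ ℝ and v ≠ 0, the Bregman Secant distortion satisfies B_F^v(z′‖z) ≥ −Q_F(z, z+v, z+v). -/
/-- The Optimal Bregman Information (OBI) of `F` at `(a, b, c)`, in the extended reals. -/
noncomputable def OBI (F : ℝ → ℝ) (a b c : ℝ) : EReal :=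
  ⨆ α ∈ {α : ℝ | α * a + (1 - α) * b ∈ Set.Icc (min a c) (max a c)},
    ((α * F a + (1 - α) * F b - F (α * a + (1 - α) * b) : ℝ) : EReal)

/-- Outside the segment, a convex function lies above its secant line. -/
lemma secant_le_of_convex {F : ℝ → ℝ} (hF : ConvexOn ℝ Set.univ F) (z v : ℝ) {t : ℝ}
    (ht : t < 0 ∨ 1 < t) : F z + t * (F (z + v) - F z) ≤ F (z + t * v) := by
  rcases ht with ht | ht
  · have h1 : 0 < 1 - t := by linarith
    have h := hF.2 (Set.mem_univ (z + v)) (Set.mem_univ (z + t * v))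
      (div_nonneg (by linarith : 0 ≤ -t) h1.le) (div_nonneg zero_le_one h1.le)
      (by field_simp; ring)
    have e : (-t / (1 - t)) • (z + v) + (1 / (1 - t)) • (z + t * v) = z := by
      simp only [smul_eq_mul]; field_simp; ring
    rw [e, smul_eq_mul, smul_eq_mul, div_mul_eq_mul_div, div_mul_eq_mul_div, ← add_div,
      le_div_iff₀ h1] at h
    linarith
  · have h1 : 0 < t := by linarith
    have h := hF.2 (Set.mem_univ z) (Set.mem_univ (z + t * v))
      (div_nonneg (by linarith : 0 ≤ t - 1) h1.le) (div_nonneg zero_le_one h1.le)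
      (by field_simp; ring)
    have e : ((t - 1) / t) • z + (1 / t) • (z + t * v) = z + v := by
      simp only [smul_eq_mul]; field_simp; ring
    rw [e, smul_eq_mul, smul_eq_mul, div_mul_eq_mul_div, div_mul_eq_mul_div, ← add_div,
      le_div_iff₀ h1] at h
    linarith

/-- Any admissible `α` gives a lower bound on the Optimal Bregman Information. -/
lemma le_OBI (F : ℝ → ℝ) {a b c α : ℝ}
    (hα : α * a + (1 - α) * b ∈ Set.Icc (min a c) (max a c)) :
    ((α * F a + (1 - α) * F b - F (α * a + (1 - α) * b) : ℝ) : EReal) ≤ OBI F a b c :=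
  le_iSup₂_of_le α hα le_rfl

/-- If `F` is convex, then `B_F^v(z'‖z) ≥ −Q_F(z, z+v, z+v)` for all `z, z'` and `v ≠ 0`. -/
theorem bregSec_ge_neg_OBI_of_convex (F : ℝ → ℝ) (hF : ConvexOn ℝ Set.univ F)
    (z z' v : ℝ) (hv : v ≠ 0) :
    -(OBI F z (z + v) (z + v)) ≤ ((bregSec F v z' z : ℝ) : EReal) := by
  obtain ⟨t, rfl⟩ : ∃ t, z' = z + t * v := ⟨(z' - z) / v, by field_simp; ring⟩
  have hB : bregSec F v (z + t * v) z = F (z + t * v) - F z - t * (F (z + v) - F z) := by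
    unfold bregSec vderiv
    field_simp
    ring
  rw [EReal.neg_le, ← EReal.coe_neg, hB]
  by_cases ht : t < 0 ∨ 1 < t
  · have h := secant_le_of_convex hF z v ht
    refine le_trans ?_ (le_OBI F (α := 1) (by simp))
    rw [EReal.coe_le_coe_iff]
    simp only [one_mul, sub_self, zero_mul, add_zero]
    linarith
  · push Not at ht
    have e : (1 - t) * z + (1 - (1 - t)) * (z + v) = z + t * v := by ring
    refine le_trans ?_ (le_OBI F (α := 1 - t) ?_)
    · rw [EReal.coe_le_coe_iff, e]
      linarith
    · rw [e, ← Set.uIcc, Set.mem_uIcc]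
      rcases le_total 0 v with h | h
      · left; constructor <;> nlinarith
      · right; constructor <;> nlinarith
end

section
/- Suppose F : ℝ → ℝ is β-smooth. Then for any a ∈ ℝ and any nonzero b, c ∈ ℝ, |∂_{{b,c}}F(a)| ≤ β + β·(min{|b|, |c|})²/|bc|, and consequently |∂_{{b,c}}F(a)| ≤ 2β. -/
/-- The second-order `{b,c}`-derivative of `F` at `z`. -/
noncomputable def vderiv2 (F : ℝ → ℝ) (b c z : ℝ) : ℝ :=
  (vderiv F b (z + c) - vderiv F b z) / c

/-- The second-order `{b,c}`-derivative of a `β`-smooth function is bounded by `β`, by the mean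
value inequality applied to `t ↦ F (t + c) - F t`. -/
theorem abs_vderiv2_le (F : ℝ → ℝ) (β : ℝ)
    (hdiff : Differentiable ℝ F)
    (hβ : ∀ x y : ℝ, |deriv F y - deriv F x| ≤ β * |y - x|)
    (a b c : ℝ) (hb : b ≠ 0) (hc : c ≠ 0) :
    |vderiv2 F b c a| ≤ β := by
  have hderiv : ∀ t ∈ (Set.univ : Set ℝ), HasDerivWithinAt (fun t => F (t + c) - F t)
      (deriv F (t + c) - deriv F t) Set.univ t := fun t _ =>
    (((hdiff (t + c)).hasDerivAt.comp_add_const t c).sub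
      (hdiff t).hasDerivAt).hasDerivWithinAt
  have hbound : ∀ t ∈ (Set.univ : Set ℝ), ‖deriv F (t + c) - deriv F t‖ ≤ β * |c| := by
    intro t _
    simpa using hβ t (t + c)
  have hmean := convex_univ.norm_image_sub_le_of_norm_hasDerivWithin_le hderiv hbound
    (Set.mem_univ a) (Set.mem_univ (a + b))
  simp only [Real.norm_eq_abs, add_sub_cancel_left] at hmean
  have heq : vderiv2 F b c a = (F (a + b + c) - F (a + b) - (F (a + c) - F a)) / (b * c) := by
    unfold vderiv2 vderiv
    rw [add_right_comm a c b]
    field_simp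
    ring
  rw [heq, abs_div, div_le_iff₀ (abs_pos.mpr (mul_ne_zero hb hc)), abs_mul]
  linarith

/-- If `F` is `β`-smooth (differentiable with `β`-Lipschitz derivative), then
`|∂_{{b,c}}F(a)| ≤ β + β·(min{|b|,|c|})²/|bc|`, and consequently
`|∂_{{b,c}}F(a)| ≤ 2β`. -/
theorem vderiv2_abs_le_two_beta (F : ℝ → ℝ) (β : ℝ)
    (hdiff : Differentiable ℝ F)
    (hβ : ∀ x y : ℝ, |deriv F y - deriv F x| ≤ β * |y - x|)
    (a : ℝ) (b c : ℝ) (hb : b ≠ 0) (hc : c ≠ 0) :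
    |vderiv2 F b c a| ≤ β + β * (min |b| |c|) ^ 2 / |b * c| ∧
    |vderiv2 F b c a| ≤ 2 * β := by
  have h := abs_vderiv2_le F β hdiff hβ a b c hb hc
  have hβ0 : 0 ≤ β := (abs_nonneg _).trans h
  have hterm : 0 ≤ β * (min |b| |c|) ^ 2 / |b * c| := by positivity
  constructor <;> linarith
end

section
/- Let F : ℝ → ℝ be convex, let z ∈ ℝ and v > 0, and set s := (F(z+v) − F(z))/v. Then the Optimal Bregman Information equals the Bregman divergence in dual coordinates: Q_F(z, z+v, z+v) = D_F(z‖s) = F(z) + F⋆(s) − z·s. -/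
/-- The convex conjugate `F⋆(s) = sup_t (s·t − F t)`, valued in the extended reals. -/
noncomputable def fconj (F : ℝ → ℝ) (s : ℝ) : EReal :=
  ⨆ t : ℝ, ((s * t - F t : ℝ) : EReal)

/-- Outside the open interval `(z, z + v)`, a convex function lies above its secant line. -/
theorem ConvexOn.secant_le_of_notMem {F : ℝ → ℝ} (hF : ConvexOn ℝ Set.univ F) {z v t : ℝ}
    (hv : 0 < v) (ht : t ∉ Set.Icc z (z + v)) :
    F z + (F (z + v) - F z) / v * (t - z) ≤ F t := by
  rw [Set.mem_Icc, not_and_or, not_le, not_le] at ht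
  rcases ht with ht | ht
  · have h := hF.slope_mono_adjacent (Set.mem_univ t) (Set.mem_univ (z + v)) ht
      (by linarith : z < z + v)
    rw [add_sub_cancel_left, div_le_iff₀ (by linarith)] at h
    linarith
  · have h := hF.slope_mono_adjacent (Set.mem_univ z) (Set.mem_univ t)
      (by linarith : z < z + v) ht
    rw [add_sub_cancel_left, le_div_iff₀ (by linarith)] at h
    have hs : (F (z + v) - F z) / v * v = F (z + v) - F z := div_mul_cancel₀ _ hv.ne'
    linarith

/-- For convex `F`, `z ∈ ℝ`, `v > 0` and `s` the secant slope of `F` on `[z, z+v]`,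
the Optimal Bregman Information equals the Bregman divergence in dual coordinates:
`Q_F(z, z+v, z+v) = D_F(z‖s) = F(z) + F⋆(s) − z·s`. -/
theorem OBI_eq_bregman (F : ℝ → ℝ) (hF : ConvexOn ℝ Set.univ F) (z v : ℝ) (hv : 0 < v) :
    OBI F z (z + v) (z + v) =
      ((F z : ℝ) : EReal) + fconj F ((F (z + v) - F z) / v)
        - ((z * ((F (z + v) - F z) / v) : ℝ) : EReal) := by
  set s := (F (z + v) - F z) / v with hs
  have hsv : s * v = F (z + v) - F z := div_mul_cancel₀ _ hv.ne'
  have hmin : min z (z + v) = z := min_eq_left (by linarith)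
  have hmax : max z (z + v) = z + v := max_eq_right (by linarith)
  have key : ∀ t ∈ Set.Icc z (z + v),
      ((F z + s * (t - z) - F t : ℝ) : EReal) ≤ OBI F z (z + v) (z + v) := by
    intro t ht
    have hα : (1 - (t - z) / v) * z + (1 - (1 - (t - z) / v)) * (z + v) = t := by
      field_simp
      ring
    unfold OBI
    refine le_iSup₂_of_le (1 - (t - z) / v) ?_ ?_
    · rw [Set.mem_ofPred_eq, hα, hmin, hmax]
      exact ht
    · rw [hα, EReal.coe_le_coe_iff, hs]
      apply le_of_eq
      field_simp
      ring
  apply le_antisymm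
  · refine iSup₂_le fun α _ => ?_
    have h : α * F z + (1 - α) * F (z + v) - F (α * z + (1 - α) * (z + v)) =
        F z + (s * (α * z + (1 - α) * (z + v)) - F (α * z + (1 - α) * (z + v))) - z * s := by
      linear_combination (α - 1) * hsv
    rw [h, EReal.coe_sub, EReal.coe_add]
    exact EReal.sub_le_sub (add_le_add le_rfl (le_iSup (fun t : ℝ => ((s * t - F t : ℝ) : EReal)) _))
      le_rfl
  · have hle : fconj F s ≤ OBI F z (z + v) (z + v) + ((z * s - F z : ℝ) : EReal) := by
      refine iSup_le fun t => ?_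
      have h : ((F z + s * (t - z) - F t : ℝ) : EReal) ≤ OBI F z (z + v) (z + v) := by
        by_cases ht : t ∈ Set.Icc z (z + v)
        · exact key t ht
        · refine le_trans ?_ (key z ⟨le_rfl, by linarith⟩)
          rw [EReal.coe_le_coe_iff]
          linarith [hF.secant_le_of_notMem hv ht]
      have e : s * t - F t = (F z + s * (t - z) - F t) + (z * s - F z) := by ring
      rw [e, EReal.coe_add]
      exact add_le_add h le_rfl
    refine (EReal.sub_le_sub (add_le_add le_rfl hle) le_rfl).trans (le_of_eq ?_)
    induction OBI F z (z + v) (z + v) with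
    | bot => simp
    | top => rw [EReal.top_add_coe, EReal.coe_add_top, EReal.top_sub_coe]
    | coe x =>
      norm_cast
      ring
end

section
/- Let F : ℝ → ℝ be convex and z, r ∈ ℝ. Then the set of positive offsets whose Optimal Bregman Information equals r coincides with the set of positive offsets whose induced secant slope is at Bregman divergence r from z: { v > 0 : Q_F(z, z+v, z+v) = r } = { v > 0 : D_F( z ‖ (F(z+v) − F(z))/v ) = r }. -/
/-- The (dual-coordinate) Bregman divergence `D_F(z'‖s) = F(z') + F⋆(s) − z'·s`. -/
noncomputable def bregDiv (F : ℝ → ℝ) (z' s : ℝ) : EReal :=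
  ((F z' : ℝ) : EReal) + fconj F s - ((z' * s : ℝ) : EReal)

/-- The gap between the graph of a convex function and the line through two of its points
is nonpositive outside the segment they span. -/
theorem ConvexOn.secant_sub_nonpos {F : ℝ → ℝ} (hF : ConvexOn ℝ Set.univ F) {z v t : ℝ}
    (hv : 0 < v) (ht : t < z ∨ z + v < t) :
    F z + (F (z + v) - F z) / v * (t - z) - F t ≤ 0 := by
  rcases ht with ht | ht
  · have h := hF.slope_mono_adjacent (Set.mem_univ t) (Set.mem_univ (z + v)) ht
      (lt_add_of_pos_right z hv)
    rw [add_sub_cancel_left, div_le_iff₀ (sub_pos.2 ht)] at h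
    linarith
  · have h := hF.secant_mono (Set.mem_univ z) (Set.mem_univ (z + v)) (Set.mem_univ t)
      (by linarith) (by linarith) ht.le
    rw [add_sub_cancel_left, le_div_iff₀ (by linarith)] at h
    linarith

theorem OBI_eq_bregDiv {F : ℝ → ℝ} (hF : ConvexOn ℝ Set.univ F) (z : ℝ) {v : ℝ} (hv : 0 < v) :
    OBI F z (z + v) (z + v) = bregDiv F z ((F (z + v) - F z) / v) := by
  set s := (F (z + v) - F z) / v with hs
  have hsv : s * v = F (z + v) - F z := div_mul_cancel₀ _ hv.ne'
  have hmin : min z (z + v) = z := min_eq_left (by linarith)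
  have hmax : max z (z + v) = z + v := max_eq_right (by linarith)
  have le_OBI : ∀ t, z ≤ t → t ≤ z + v →
      ((F z + s * (t - z) - F t : ℝ) : EReal) ≤ OBI F z (z + v) (z + v) := by
    intro t h₁ h₂
    have hα : (1 - (t - z) / v) * z + (1 - (1 - (t - z) / v)) * (z + v) = t := by
      field_simp
      ring
    refine le_trans (le_of_eq ?_) (le_iSup₂_of_le (1 - (t - z) / v) ?_ le_rfl)
    · rw [hα, hs]
      congr 1
      ring
    · rw [Set.mem_ofPred_eq, hα, hmin, hmax]
      exact ⟨h₁, h₂⟩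
  apply le_antisymm
  · refine iSup₂_le fun α _ => ?_
    set t := α * z + (1 - α) * (z + v) with ht
    have hval : α * F z + (1 - α) * F (z + v) - F t = F z + (s * t - F t) - z * s := by
      rw [ht]
      linear_combination (α - 1) * hsv
    rw [hval, EReal.coe_sub, EReal.coe_add]
    exact EReal.sub_le_sub (add_le_add le_rfl (le_iSup (fun t : ℝ => ((s * t - F t : ℝ) : EReal)) t))
      le_rfl
  · unfold bregDiv
    rw [EReal.sub_le_iff_le_add (Or.inl (EReal.coe_ne_bot _)) (Or.inl (EReal.coe_ne_top _)),
      add_comm, ← EReal.le_sub_iff_add_le (Or.inl (EReal.coe_ne_bot _))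
        (Or.inl (EReal.coe_ne_top _))]
    refine iSup_le fun t => ?_
    rw [EReal.le_sub_iff_add_le (Or.inl (EReal.coe_ne_bot _)) (Or.inl (EReal.coe_ne_top _)),
      ← EReal.sub_le_iff_le_add (Or.inl (EReal.coe_ne_bot _)) (Or.inl (EReal.coe_ne_top _)),
      ← EReal.coe_add, ← EReal.coe_sub,
      show s * t - F t + F z - z * s = F z + s * (t - z) - F t by ring]
    by_cases h : z ≤ t ∧ t ≤ z + v
    · exact le_OBI t h.1 h.2
    · have hneg : t < z ∨ z + v < t := by
        by_contra! hc
        exact h hc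
      refine le_trans ?_ (le_OBI z le_rfl (by linarith))
      rw [EReal.coe_le_coe_iff, sub_self, mul_zero, add_zero, sub_self]
      exact hF.secant_sub_nonpos hv hneg

/-- For convex `F`, the set of positive offsets whose Optimal Bregman Information
equals `r` coincides with the set of positive offsets whose induced secant slope is
at Bregman divergence `r` from `z`. -/
theorem OBI_level_set_eq_bregman_level_set (F : ℝ → ℝ) (hF : ConvexOn ℝ Set.univ F)
    (z r : ℝ) :
    {v : ℝ | 0 < v ∧ OBI F z (z + v) (z + v) = (r : EReal)} =
    {v : ℝ | 0 < v ∧ bregDiv F z ((F (z + v) - F z) / v) = (r : EReal)} := by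
  ext v
  simp only [Set.mem_ofPred_eq]
  exact and_congr_right fun hv => by rw [OBI_eq_bregDiv hF z hv]
end

section
/- (Per-iteration loss decrease.) Let F : ℝ → ℝ and m ≥ 1. For each i ∈ {1,…,m} let ẽᵢ ∈ ℝ, let bᵢ ≠ 0 with |bᵢ| ≤ M for some M > 0, let vᵢ ≠ 0, and set the weight wᵢ := −∂_{vᵢ}F(ẽᵢ) and edge η := (1/m) Σᵢ wᵢ bᵢ, with η ≠ 0. Let W̄₂ > 0, ε > 0, π ∈ (0,1), and let α ∈ (η/(2(1+ε)M²W̄₂)) · [1−π, 1+π]. Suppose (1/m) Σᵢ ∂_{{αbᵢ, vᵢ}}F(ẽᵢ) · (bᵢ/M)² ≤ W̄₂, define the updated edges ẽ′ᵢ := ẽᵢ + αbᵢ, and suppose Q_F(ẽ′ᵢ, ẽ′ᵢ + vᵢ, ẽᵢ) ≤ ε·α²·M²·W̄₂ for every i. Then (1/m) Σᵢ F(ẽ′ᵢ) ≤ (1/m) Σᵢ F(ẽᵢ) − η²(1−π²)/(4(1+ε)M²W̄₂). -/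
/-- The secant slope at a shifted point, in terms of the slope at the original point and the
second-order derivative. -/
lemma vderiv_add_eq (F : ℝ → ℝ) {c : ℝ} (hc : c ≠ 0) (v z : ℝ) :
    vderiv F v (z + c) = vderiv F v z + c * vderiv2 F c v z := by
  by_cases hv : v = 0
  · simp [vderiv, vderiv2, hv]
  · unfold vderiv vderiv2 vderiv
    rw [show z + v + c = z + c + v by ring]
    field_simp
    ring

/-- The OBI bounds the gap at `c` between `F` and its secant through `a` and `a + v`. -/
lemma sub_sub_mul_vderiv_le_of_OBI_le (F : ℝ → ℝ) {a v c r : ℝ} (hv : v ≠ 0)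
    (h : OBI F a (a + v) c ≤ (r : EReal)) :
    F a - F c - (a - c) * vderiv F v a ≤ r := by
  have hpt : (1 + (a - c) / v) * a + (1 - (1 + (a - c) / v)) * (a + v) = c := by
    field_simp
    ring
  have hmem : 1 + (a - c) / v ∈
      {γ : ℝ | γ * a + (1 - γ) * (a + v) ∈ Set.Icc (min a c) (max a c)} := by
    rw [Set.mem_ofPred_eq, hpt]
    exact ⟨min_le_right a c, le_max_right a c⟩
  have hle := EReal.coe_le_coe_iff.mp ((le_iSup₂ (f := fun (γ : ℝ)
    (_ : γ ∈ {γ : ℝ | γ * a + (1 - γ) * (a + v) ∈ Set.Icc (min a c) (max a c)}) =>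
    ((γ * F a + (1 - γ) * F (a + v) - F (γ * a + (1 - γ) * (a + v)) : ℝ) : EReal))
    _ hmem).trans h)
  rw [hpt] at hle
  refine le_trans (le_of_eq ?_) hle
  unfold vderiv
  field_simp
  ring

/-- Value of a quadratic with minimizer `η / (2 * K)` at a point of relative error `π`. -/
lemma quadratic_le_of_mem_relative_interval {η K π α : ℝ} (hK : 0 < K)
    (hα : α ∈ Set.Icc (min (η / (2 * K) * (1 - π)) (η / (2 * K) * (1 + π)))
        (max (η / (2 * K) * (1 - π)) (η / (2 * K) * (1 + π)))) :
    -(α * η) + α ^ 2 * K ≤ -(η ^ 2 * (1 - π ^ 2) / (4 * K)) := by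
  obtain ⟨u, hu⟩ : ∃ u, u = η / (2 * K) := ⟨_, rfl⟩
  have hη : η = 2 * K * u := by rw [hu]; field_simp
  rw [← hu] at hα
  have hprod : (α - u * (1 - π)) * (α - u * (1 + π)) ≤ 0 := by
    obtain ⟨h₁, h₂⟩ := hα
    rcases le_total (u * (1 - π)) (u * (1 + π)) with h | h
    · rw [min_eq_left h] at h₁
      rw [max_eq_right h] at h₂
      exact mul_nonpos_of_nonneg_of_nonpos (by linarith) (by linarith)
    · rw [min_eq_right h] at h₁
      rw [max_eq_left h] at h₂
      exact mul_nonpos_of_nonpos_of_nonneg (by linarith) (by linarith)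
  have hrhs : η ^ 2 * (1 - π ^ 2) / (4 * K) = K * u ^ 2 * (1 - π ^ 2) := by
    rw [hη]
    field_simp
    ring
  rw [hrhs, hη]
  nlinarith [mul_nonpos_of_nonneg_of_nonpos hK.le hprod]

/-- Per-iteration loss decrease of SecantBoost. -/
theorem secantboost_per_iteration (F : ℝ → ℝ) (m : ℕ) (hm : 1 ≤ m)
    (e b v : Fin m → ℝ) (M : ℝ) (hM : 0 < M)
    (hb : ∀ i, b i ≠ 0) (hbM : ∀ i, |b i| ≤ M)
    (hv : ∀ i, v i ≠ 0)
    (w : Fin m → ℝ) (hw : ∀ i, w i = - vderiv F (v i) (e i))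
    (η : ℝ) (hη : η = (1 / (m : ℝ)) * ∑ i, w i * b i) (hη0 : η ≠ 0)
    (W2 ε π α : ℝ) (hW2 : 0 < W2) (hε : 0 < ε) (hπ0 : 0 < π) (hπ1 : π < 1)
    (hα : α ∈ Set.Icc
        (min (η / (2 * (1 + ε) * M ^ 2 * W2) * (1 - π))
             (η / (2 * (1 + ε) * M ^ 2 * W2) * (1 + π)))
        (max (η / (2 * (1 + ε) * M ^ 2 * W2) * (1 - π))
             (η / (2 * (1 + ε) * M ^ 2 * W2) * (1 + π))))
    (hsum : (1 / (m : ℝ)) * ∑ i, vderiv2 F (α * b i) (v i) (e i) * (b i / M) ^ 2 ≤ W2)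
    (hQ : ∀ i, OBI F (e i + α * b i) (e i + α * b i + v i) (e i) ≤
        ((ε * α ^ 2 * M ^ 2 * W2 : ℝ) : EReal)) :
    (1 / (m : ℝ)) * ∑ i, F (e i + α * b i) ≤
      (1 / (m : ℝ)) * ∑ i, F (e i) - η ^ 2 * (1 - π ^ 2) / (4 * (1 + ε) * M ^ 2 * W2) := by
  have hK : 0 < (1 + ε) * M ^ 2 * W2 := by positivity
  have hm0 : (0 : ℝ) < m := by exact_mod_cast hm
  have hπ1' : 0 < 1 - π := by linarith
  have hα0 : α ≠ 0 := by
    rintro rfl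
    obtain ⟨h₁, h₂⟩ := hα
    have hη' : 0 < η ∨ η < 0 := (lt_or_gt_of_ne hη0).symm
    have hD : 0 < 2 * (1 + ε) * M ^ 2 * W2 := by positivity
    rcases hη' with h | h
    · have hu := div_pos h hD
      exact absurd h₁ (not_le.mpr (lt_min (mul_pos hu hπ1') (mul_pos hu (by linarith))))
    · have hu := div_neg_of_neg_of_pos h hD
      exact absurd h₂ (not_le.mpr (max_lt (mul_neg_of_neg_of_pos hu hπ1')
        (mul_neg_of_neg_of_pos hu (by linarith))))
  have hquad := quadratic_le_of_mem_relative_interval (η := η) (α := α) hK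
    (by simpa only [← mul_assoc] using hα)
  have hterm : ∀ i, F (e i + α * b i) ≤ F (e i) - α * (w i * b i)
      + α ^ 2 * M ^ 2 * (vderiv2 F (α * b i) (v i) (e i) * (b i / M) ^ 2)
      + ε * α ^ 2 * M ^ 2 * W2 := by
    intro i
    have h := sub_sub_mul_vderiv_le_of_OBI_le F (hv i) (hQ i)
    rw [vderiv_add_eq F (mul_ne_zero hα0 (hb i))] at h
    have hM2 : α ^ 2 * M ^ 2 * (vderiv2 F (α * b i) (v i) (e i) * (b i / M) ^ 2)
        = (α * b i) ^ 2 * vderiv2 F (α * b i) (v i) (e i) := by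
      field_simp
    rw [hM2, hw i]
    linarith
  have hmean : (1 / (m : ℝ)) * ∑ i, F (e i + α * b i) ≤
      (1 / (m : ℝ)) * ∑ i, F (e i) - α * η
      + α ^ 2 * M ^ 2 * ((1 / (m : ℝ)) *
        ∑ i, vderiv2 F (α * b i) (v i) (e i) * (b i / M) ^ 2)
      + ε * α ^ 2 * M ^ 2 * W2 := by
    refine (mul_le_mul_of_nonneg_left (Finset.sum_le_sum fun i _ => hterm i)
      (by positivity)).trans (le_of_eq ?_)
    rw [Finset.sum_add_distrib, Finset.sum_add_distrib, Finset.sum_sub_distrib,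
      ← Finset.mul_sum, ← Finset.mul_sum, Finset.sum_const, Finset.card_univ, Fintype.card_fin,
      nsmul_eq_mul, hη]
    field_simp
  have hcurv := mul_le_mul_of_nonneg_left hsum (by positivity : 0 ≤ α ^ 2 * M ^ 2)
  rw [show 4 * (1 + ε) * M ^ 2 * W2 = 4 * ((1 + ε) * M ^ 2 * W2) by ring]
  linarith
end

section
/- (Convergence of SecantBoost, sequence form.) Let F : ℝ → ℝ, m ≥ 1, T ≥ 1. For each i ∈ {1,…,m} and t ∈ {1,…,T}, suppose given: nonzero reals b_{ti} (the signed weak predictions) with M_t := max_i |b_{ti}|; leveraging coefficients α_t ≠ 0; initial edges ẽ_{0i} ∈ ℝ and updated edges ẽ_{ti} := ẽ_{(t−1)i} + α_t b_{ti}; nonzero offsets v_{ti} for t ∈ {0,…,T−1}; weights w_{ti} := −∂_{v_{(t−1)i}}F(ẽ_{(t−1)i}); the unnormalized edge η_t := (1/m) Σᵢ w_{ti} b_{ti}; W_t := Σᵢ |w_{ti}| > 0 and the normalized edge η̃_t := (1/(W_t M_t)) Σᵢ w_{ti} b_{ti}; and W̄_{1,t} := |(1/m) Σᵢ w_{ti}|.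 Assume for each t ∈ {1,…,T}: (i) W̄_{2,t} > 0 with (1/m) Σᵢ ∂_{{α_t b_{ti}, v_{(t−1)i}}}F(ẽ_{(t−1)i}) · (b_{ti}/M_t)² ≤ W̄_{2,t}; (ii) there exist ε_t > 0 and π_t ∈ (0,1) with α_t ∈ (η_t/(2(1+ε_t)M_t² W̄_{2,t})) · [1−π_t, 1+π_t]; (iii) Q_F(ẽ_{ti}, ẽ_{ti} + v_{(t−1)i}, ẽ_{(t−1)i}) ≤ ε_t α_t² M_t² W̄_{2,t} for every i. Let F₀ := (1/m) Σᵢ F(ẽ_{0i}) and let z* ∈ ℝ with F(z*) ≤ F₀. If Σ_{t=1}^{T} (W̄²_{1,t}(1−π_t²)/(W̄_{2,t}(1+ε_t))) · η̃_t² ≥ 4(F₀ − F(z*)), then (1/m) Σᵢ F(ẽ_{Ti}) ≤ F(z*). -/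
/-- The secant Bregman divergence is bounded by the Optimal Bregman Information: any bound `C` on
the latter controls the increment of `F` through the `v`-derivative at the end point. -/
theorem sub_le_mul_vderiv_add_of_OBI_le {F : ℝ → ℝ} {z z' v C : ℝ} (hv : v ≠ 0)
    (h : OBI F z' (z' + v) z ≤ (C : EReal)) :
    F z' - F z ≤ (z' - z) * vderiv F v z' + C := by
  have hz : (1 + (z' - z) / v : ℝ) * z' + (1 - (1 + (z' - z) / v)) * (z' + v) = z := by
    field_simp
    ring
  have hmem : (1 + (z' - z) / v : ℝ) ∈
      {α : ℝ | α * z' + (1 - α) * (z' + v) ∈ Set.Icc (min z' z) (max z' z)} := by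
    rw [Set.mem_ofPred_eq, hz]
    exact ⟨min_le_right _ _, le_max_right _ _⟩
  have hle := (le_iSup₂ (f := fun (α : ℝ)
    (_ : α ∈ {α : ℝ | α * z' + (1 - α) * (z' + v) ∈ Set.Icc (min z' z) (max z' z)}) =>
      ((α * F z' + (1 - α) * F (z' + v) - F (α * z' + (1 - α) * (z' + v)) : ℝ) : EReal))
    _ hmem).trans h
  rw [EReal.coe_le_coe_iff, hz] at hle
  have hd : (z' - z) * vderiv F v z' = (z' - z) / v * (F (z' + v) - F z') := by
    unfold vderiv
    ring
  rw [hd]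
  linarith

theorem vderiv_add_eq_vderiv_add_mul_vderiv2 (F : ℝ → ℝ) {d v : ℝ} (hd : d ≠ 0) (z : ℝ) :
    vderiv F v (z + d) = vderiv F v z + d * vderiv2 F d v z := by
  unfold vderiv2 vderiv
  rw [add_right_comm z d v]
  field_simp
  ring

theorem sq_mul_sub_mul_le_of_mem_Icc {K η π a : ℝ} (hK : 0 < K) (hπ : 0 ≤ π)
    (ha : a ∈ Set.Icc (min (η / (2 * K) * (1 - π)) (η / (2 * K) * (1 + π)))
      (max (η / (2 * K) * (1 - π)) (η / (2 * K) * (1 + π)))) :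
    a ^ 2 * K - a * η ≤ -((1 - π ^ 2) * η ^ 2 / (4 * K)) := by
  obtain ⟨c, hc⟩ : ∃ c, c = η / (2 * K) := ⟨_, rfl⟩
  have hη : η = 2 * K * c := by rw [hc]; field_simp
  rw [← hc] at ha
  have hsq : (a - c) ^ 2 ≤ π ^ 2 * c ^ 2 := by
    rcases le_total 0 c with h | h
    · have hcp := mul_nonneg h hπ
      rw [min_eq_left (by nlinarith), max_eq_right (by nlinarith)] at ha
      nlinarith [mul_nonneg (sub_nonneg.2 ha.1) (sub_nonneg.2 ha.2)]
    · have hcp := mul_nonneg (neg_nonneg.2 h) hπ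
      rw [min_eq_right (by nlinarith), max_eq_left (by nlinarith)] at ha
      nlinarith [mul_nonneg (sub_nonneg.2 ha.1) (sub_nonneg.2 ha.2)]
  have hr : (1 - π ^ 2) * η ^ 2 / (4 * K) = (1 - π ^ 2) * c ^ 2 * K := by
    rw [hη]
    field_simp
    ring
  rw [hr, hη]
  nlinarith [mul_le_mul_of_nonneg_right hsq hK.le]

/-- One boosting iteration decreases the average loss by at least the guaranteed rate. -/
theorem average_loss_step_le {F : ℝ → ℝ} {m : ℕ} (hm : 1 ≤ m) {b e e' v w : Fin m → ℝ}
    {α M W2 ε π : ℝ} (hb : ∀ i, b i ≠ 0) (hα : α ≠ 0) (he : ∀ i, e' i = e i + α * b i)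
    (hv : ∀ i, v i ≠ 0) (hM : 0 < M) (hw : ∀ i, w i = -vderiv F (v i) (e i))
    (hW : 0 < ∑ i, |w i|) (hW2pos : 0 < W2)
    (hW2 : (1 / (m : ℝ)) * ∑ i, vderiv2 F (α * b i) (v i) (e i) * (b i / M) ^ 2 ≤ W2)
    (hε : 0 < ε) (hπ : 0 < π) (hπ1 : π < 1)
    (hαmem : α ∈ Set.Icc
      (min ((1 / (m : ℝ)) * (∑ i, w i * b i) / (2 * (1 + ε) * M ^ 2 * W2) * (1 - π))
        ((1 / (m : ℝ)) * (∑ i, w i * b i) / (2 * (1 + ε) * M ^ 2 * W2) * (1 + π)))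
      (max ((1 / (m : ℝ)) * (∑ i, w i * b i) / (2 * (1 + ε) * M ^ 2 * W2) * (1 - π))
        ((1 / (m : ℝ)) * (∑ i, w i * b i) / (2 * (1 + ε) * M ^ 2 * W2) * (1 + π))))
    (hQ : ∀ i, OBI F (e' i) (e' i + v i) (e i) ≤ ((ε * α ^ 2 * M ^ 2 * W2 : ℝ) : EReal)) :
    (|(1 / (m : ℝ)) * ∑ i, w i| ^ 2 * (1 - π ^ 2) / (W2 * (1 + ε))) *
        ((1 / ((∑ i, |w i|) * M)) * ∑ i, w i * b i) ^ 2 ≤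
      4 * ((1 / (m : ℝ)) * ∑ i, F (e i) - (1 / (m : ℝ)) * ∑ i, F (e' i)) := by
  have hm0 : (0 : ℝ) < m := by exact_mod_cast hm
  have hπ2 : 0 ≤ 1 - π ^ 2 := by nlinarith
  have hpt : ∀ i, F (e' i) - F (e i) ≤ -(α * (w i * b i)) +
      α ^ 2 * M ^ 2 * (vderiv2 F (α * b i) (v i) (e i) * (b i / M) ^ 2) +
      ε * α ^ 2 * M ^ 2 * W2 := by
    intro i
    have h := sub_le_mul_vderiv_add_of_OBI_le (hv i) (hQ i)
    rw [he i, vderiv_add_eq_vderiv_add_mul_vderiv2 F (mul_ne_zero hα (hb i))] at h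
    rw [he i]
    refine h.trans_eq ?_
    rw [hw i]
    field_simp
    ring
  have hsum := Finset.sum_le_sum fun i (_ : i ∈ Finset.univ) => hpt i
  simp only [Finset.sum_sub_distrib, Finset.sum_add_distrib, Finset.sum_neg_distrib,
    ← Finset.mul_sum, Finset.sum_const, Finset.card_univ, Fintype.card_fin, nsmul_eq_mul] at hsum
  set S := ∑ i, w i * b i
  set D := ∑ i, vderiv2 F (α * b i) (v i) (e i) * (b i / M) ^ 2
  have hK : 0 < (1 + ε) * M ^ 2 * W2 := by positivity
  have hquad := sq_mul_sub_mul_le_of_mem_Icc hK hπ.le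
    (by simpa only [mul_assoc] using hαmem :
      α ∈ Set.Icc
        (min ((1 / (m : ℝ)) * S / (2 * ((1 + ε) * M ^ 2 * W2)) * (1 - π))
          ((1 / (m : ℝ)) * S / (2 * ((1 + ε) * M ^ 2 * W2)) * (1 + π)))
        (max ((1 / (m : ℝ)) * S / (2 * ((1 + ε) * M ^ 2 * W2)) * (1 - π))
          ((1 / (m : ℝ)) * S / (2 * ((1 + ε) * M ^ 2 * W2)) * (1 + π))))
  have havg := mul_le_mul_of_nonneg_left hsum (one_div_nonneg.2 hm0.le)
  have hmm : 1 / (m : ℝ) * m = 1 := by field_simp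
  have hD := mul_le_mul_of_nonneg_left hW2 (by positivity : 0 ≤ α ^ 2 * M ^ 2)
  have hdec : 1 / (m : ℝ) * ∑ i, F (e' i) - 1 / (m : ℝ) * ∑ i, F (e i) ≤
      -((1 - π ^ 2) * (1 / (m : ℝ) * S) ^ 2 / (4 * ((1 + ε) * M ^ 2 * W2))) := by
    refine le_trans ?_ hquad
    linear_combination havg + hD + (ε * α ^ 2 * M ^ 2 * W2) * hmm
  have habs : |(1 / (m : ℝ)) * ∑ i, w i| ^ 2 ≤ (1 / (m : ℝ) * ∑ i, |w i|) ^ 2 := by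
    rw [abs_mul, abs_of_pos (one_div_pos.2 hm0)]
    gcongr
    exact Finset.abs_sum_le_sum_abs _ _
  calc _ ≤ ((1 / (m : ℝ) * ∑ i, |w i|) ^ 2 * (1 - π ^ 2) / (W2 * (1 + ε))) *
        ((1 / ((∑ i, |w i|) * M)) * S) ^ 2 := by gcongr
    _ = 4 * ((1 - π ^ 2) * (1 / (m : ℝ) * S) ^ 2 / (4 * ((1 + ε) * M ^ 2 * W2))) := by
      field_simp
    _ ≤ _ := by linarith

/-- Convergence of SecantBoost, sequence form. -/
theorem secantboost_convergence (F : ℝ → ℝ) (m T : ℕ) (hm : 1 ≤ m) (hT : 1 ≤ T)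
    (b : ℕ → Fin m → ℝ) (α : ℕ → ℝ) (e : ℕ → Fin m → ℝ) (v : ℕ → Fin m → ℝ)
    (M : ℕ → ℝ)
    (hb : ∀ t ∈ Finset.Icc 1 T, ∀ i, b t i ≠ 0)
    (hα : ∀ t ∈ Finset.Icc 1 T, α t ≠ 0)
    (he : ∀ t ∈ Finset.Icc 1 T, ∀ i, e t i = e (t - 1) i + α t * b t i)
    (hv : ∀ t < T, ∀ i, v t i ≠ 0)
    (hM : ∀ t ∈ Finset.Icc 1 T, (∀ i, |b t i| ≤ M t) ∧ ∃ i, |b t i| = M t)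
    (w : ℕ → Fin m → ℝ)
    (hw : ∀ t ∈ Finset.Icc 1 T, ∀ i, w t i = - vderiv F (v (t - 1) i) (e (t - 1) i))
    (η W ηnorm W1 W2 : ℕ → ℝ)
    (hη : ∀ t ∈ Finset.Icc 1 T, η t = (1 / (m : ℝ)) * ∑ i, w t i * b t i)
    (hW : ∀ t ∈ Finset.Icc 1 T, W t = ∑ i, |w t i|)
    (hWpos : ∀ t ∈ Finset.Icc 1 T, 0 < W t)
    (hηnorm : ∀ t ∈ Finset.Icc 1 T, ηnorm t = (1 / (W t * M t)) * ∑ i, w t i * b t i)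
    (hW1 : ∀ t ∈ Finset.Icc 1 T, W1 t = |(1 / (m : ℝ)) * ∑ i, w t i|)
    (hW2pos : ∀ t ∈ Finset.Icc 1 T, 0 < W2 t)
    (hW2 : ∀ t ∈ Finset.Icc 1 T,
      (1 / (m : ℝ)) * ∑ i, vderiv2 F (α t * b t i) (v (t - 1) i) (e (t - 1) i)
          * (b t i / M t) ^ 2 ≤ W2 t)
    (ε π : ℕ → ℝ)
    (hε : ∀ t ∈ Finset.Icc 1 T, 0 < ε t)
    (hπ : ∀ t ∈ Finset.Icc 1 T, 0 < π t ∧ π t < 1)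
    (hαmem : ∀ t ∈ Finset.Icc 1 T, α t ∈ Set.Icc
        (min (η t / (2 * (1 + ε t) * M t ^ 2 * W2 t) * (1 - π t))
             (η t / (2 * (1 + ε t) * M t ^ 2 * W2 t) * (1 + π t)))
        (max (η t / (2 * (1 + ε t) * M t ^ 2 * W2 t) * (1 - π t))
             (η t / (2 * (1 + ε t) * M t ^ 2 * W2 t) * (1 + π t))))
    (hQ : ∀ t ∈ Finset.Icc 1 T, ∀ i,
      OBI F (e t i) (e t i + v (t - 1) i) (e (t - 1) i) ≤
        ((ε t * α t ^ 2 * M t ^ 2 * W2 t : ℝ) : EReal))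
    (F0 zstar : ℝ) (hF0 : F0 = (1 / (m : ℝ)) * ∑ i, F (e 0 i))
    (hzstar : F zstar ≤ F0)
    (hrate : 4 * (F0 - F zstar) ≤
      ∑ t ∈ Finset.Icc 1 T, (W1 t ^ 2 * (1 - π t ^ 2) / (W2 t * (1 + ε t))) * ηnorm t ^ 2) :
    (1 / (m : ℝ)) * ∑ i, F (e T i) ≤ F zstar := by
  have hstep : ∀ t ∈ Finset.Icc 1 T,
      (W1 t ^ 2 * (1 - π t ^ 2) / (W2 t * (1 + ε t))) * ηnorm t ^ 2 ≤
        4 * ((1 / (m : ℝ)) * ∑ i, F (e (t - 1) i) - (1 / (m : ℝ)) * ∑ i, F (e t i)) := by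
    intro t ht
    have hMpos : 0 < M t := by
      obtain ⟨i, hi⟩ := (hM t ht).2
      exact hi ▸ abs_pos.2 (hb t ht i)
    have hlt : t - 1 < T := by
      have := Finset.mem_Icc.1 ht
      omega
    rw [hW1 t ht, hηnorm t ht, hW t ht]
    exact average_loss_step_le hm (hb t ht) (hα t ht) (he t ht) (hv _ hlt) hMpos (hw t ht)
      (hW t ht ▸ hWpos t ht) (hW2pos t ht) (hW2 t ht) (hε t ht) (hπ t ht).1 (hπ t ht).2
      (hη t ht ▸ hαmem t ht) (hQ t ht)
  have htel : ∑ t ∈ Finset.Icc 1 T,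
      4 * ((1 / (m : ℝ)) * ∑ i, F (e (t - 1) i) - (1 / (m : ℝ)) * ∑ i, F (e t i)) =
        4 * (F0 - (1 / (m : ℝ)) * ∑ i, F (e T i)) := by
    rw [← Finset.mul_sum, hF0, ← Finset.Ico_add_one_right_eq_Icc, Finset.sum_Ico_eq_sum_range]
    simp only [Nat.add_sub_cancel, add_comm 1]
    rw [Finset.sum_range_sub' fun t => (1 / (m : ℝ)) * ∑ i, F (e t i)]
  linarith [hrate.trans (Finset.sum_le_sum hstep)]
end

section
/- (Boosting-compliant convergence rate.) Under the same sequence setup as the convergence theorem for SecantBoost — edges ẽ_{ti} = ẽ_{(t−1)i} + α_t b_{ti}, weights w_{ti} = −∂_{v_{(t−1)i}}F(ẽ_{(t−1)i}), conditions (i)–(iii) on W̄_{2,t}, α_t, ε_t, π_t and the offsets — assume additionally the γ-Weak Learning Assumption: there exists γ > 0 with |η̃_t| ≥ γ for all t ∈ {1,…,T}; and the ρ-Weight Regularity Assumption: there exists ρ > 0 with W̄²_{1,t}/W̄_{2,t} > ρ for all t ∈ {1,…,T}. Let F₀ := (1/m) Σᵢ F(ẽ_{0i}) and z ∈ ℝ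 with F(z) ≤ F₀. If T ≥ (4(F₀ − F(z))/(γ²ρ)) · (1 + max_{t∈[T]} ε_t)/(1 − max_{t∈[T]} π_t²), then (1/m) Σᵢ F(ẽ_{Ti}) ≤ F(z). -/
/-- A bound on the OBI controls the increment `F (z + d) - F z` by its first- and second-order
secant expansion. -/
theorem sub_le_of_OBI_le {F : ℝ → ℝ} {z d v q : ℝ} (hd : d ≠ 0) (hv : v ≠ 0)
    (h : OBI F (z + d) (z + d + v) z ≤ (q : EReal)) :
    F (z + d) - F z ≤ q + d ^ 2 * vderiv2 F d v z + d * vderiv F v z := by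
  have hz : (1 + d / v) * (z + d) + (1 - (1 + d / v)) * (z + d + v) = z := by
    field_simp
    ring
  have hle := (le_iSup₂_of_le (f := fun (α : ℝ)
      (_ : α ∈ {α : ℝ | α * (z + d) + (1 - α) * (z + d + v) ∈
        Set.Icc (min (z + d) z) (max (z + d) z)}) =>
      ((α * F (z + d) + (1 - α) * F (z + d + v)
        - F (α * (z + d) + (1 - α) * (z + d + v)) : ℝ) : EReal))
    (1 + d / v) (by rw [Set.mem_ofPred_eq, hz]; exact ⟨min_le_right _ _, le_max_right _ _⟩)
    le_rfl).trans h
  rw [EReal.coe_le_coe_iff, hz] at hle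
  have hexp : d ^ 2 * vderiv2 F d v z + d * vderiv F v z
      = d / v * (F (z + d + v) - F (z + d)) := by
    unfold vderiv2 vderiv
    rw [add_right_comm z v d]
    field_simp
    ring
  linarith

/-- Value of a quadratic `K x² - x η` for a step `x` within relative distance `p` of its
minimizer `η / (2 K)`. -/
theorem quadratic_step_le {K η x p : ℝ} (hK : 0 < K) (hp : 0 < p)
    (hx : x ∈ Set.Icc (min (η / (2 * K) * (1 - p)) (η / (2 * K) * (1 + p)))
      (max (η / (2 * K) * (1 - p)) (η / (2 * K) * (1 + p)))) :
    K * x ^ 2 - x * η ≤ -(η ^ 2 / (4 * K) * (1 - p ^ 2)) := by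
  set c := η / (2 * K) with hc
  have hη : η = 2 * K * c := by rw [hc]; field_simp
  have habs : |x - c| ≤ |c * p| := by
    rw [abs_le]
    rcases le_total 0 c with h | h
    · have : 0 ≤ c * p := by positivity
      rw [min_eq_left (by nlinarith), max_eq_right (by nlinarith)] at hx
      rw [abs_of_nonneg this]
      constructor <;> nlinarith [hx.1, hx.2]
    · have : c * p ≤ 0 := mul_nonpos_of_nonpos_of_nonneg h hp.le
      rw [min_eq_right (by nlinarith), max_eq_left (by nlinarith)] at hx
      rw [abs_of_nonpos this]
      constructor <;> nlinarith [hx.1, hx.2]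
  have hsq := mul_le_mul_of_nonneg_left (sq_le_sq.mpr habs) hK.le
  have hq : η ^ 2 / (4 * K) = K * c ^ 2 := by rw [hη]; field_simp; ring
  rw [hq, hη]
  nlinarith

/-- Boosting-compliant convergence rate of SecantBoost, under the γ-Weak Learning
Assumption and the ρ-Weight Regularity Assumption. -/
theorem secantboost_boosting_rate (F : ℝ → ℝ) (m T : ℕ) (hm : 1 ≤ m) (hT : 1 ≤ T)
    (b : ℕ → Fin m → ℝ) (α : ℕ → ℝ) (e : ℕ → Fin m → ℝ) (v : ℕ → Fin m → ℝ)
    (M : ℕ → ℝ)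
    (hb : ∀ t ∈ Finset.Icc 1 T, ∀ i, b t i ≠ 0)
    (hα : ∀ t ∈ Finset.Icc 1 T, α t ≠ 0)
    (he : ∀ t ∈ Finset.Icc 1 T, ∀ i, e t i = e (t - 1) i + α t * b t i)
    (hv : ∀ t < T, ∀ i, v t i ≠ 0)
    (hM : ∀ t ∈ Finset.Icc 1 T, (∀ i, |b t i| ≤ M t) ∧ ∃ i, |b t i| = M t)
    (w : ℕ → Fin m → ℝ)
    (hw : ∀ t ∈ Finset.Icc 1 T, ∀ i, w t i = - vderiv F (v (t - 1) i) (e (t - 1) i))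
    (η W ηnorm W1 W2 : ℕ → ℝ)
    (hη : ∀ t ∈ Finset.Icc 1 T, η t = (1 / (m : ℝ)) * ∑ i, w t i * b t i)
    (hW : ∀ t ∈ Finset.Icc 1 T, W t = ∑ i, |w t i|)
    (hWpos : ∀ t ∈ Finset.Icc 1 T, 0 < W t)
    (hηnorm : ∀ t ∈ Finset.Icc 1 T, ηnorm t = (1 / (W t * M t)) * ∑ i, w t i * b t i)
    (hW1 : ∀ t ∈ Finset.Icc 1 T, W1 t = |(1 / (m : ℝ)) * ∑ i, w t i|)
    (hW2pos : ∀ t ∈ Finset.Icc 1 T, 0 < W2 t)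
    (hW2 : ∀ t ∈ Finset.Icc 1 T,
      (1 / (m : ℝ)) * ∑ i, vderiv2 F (α t * b t i) (v (t - 1) i) (e (t - 1) i)
          * (b t i / M t) ^ 2 ≤ W2 t)
    (ε π : ℕ → ℝ)
    (hε : ∀ t ∈ Finset.Icc 1 T, 0 < ε t)
    (hπ : ∀ t ∈ Finset.Icc 1 T, 0 < π t ∧ π t < 1)
    (hαmem : ∀ t ∈ Finset.Icc 1 T, α t ∈ Set.Icc
        (min (η t / (2 * (1 + ε t) * M t ^ 2 * W2 t) * (1 - π t))
             (η t / (2 * (1 + ε t) * M t ^ 2 * W2 t) * (1 + π t)))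
        (max (η t / (2 * (1 + ε t) * M t ^ 2 * W2 t) * (1 - π t))
             (η t / (2 * (1 + ε t) * M t ^ 2 * W2 t) * (1 + π t))))
    (hQ : ∀ t ∈ Finset.Icc 1 T, ∀ i,
      OBI F (e t i) (e t i + v (t - 1) i) (e (t - 1) i) ≤
        ((ε t * α t ^ 2 * M t ^ 2 * W2 t : ℝ) : EReal))
    -- γ-Weak Learning Assumption
    (γ : ℝ) (hγ : 0 < γ) (hWLA : ∀ t ∈ Finset.Icc 1 T, γ ≤ |ηnorm t|)
    -- ρ-Weight Regularity Assumption
    (ρ : ℝ) (hρ : 0 < ρ) (hWRA : ∀ t ∈ Finset.Icc 1 T, ρ < W1 t ^ 2 / W2 t)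
    (F0 zstar : ℝ) (hF0 : F0 = (1 / (m : ℝ)) * ∑ i, F (e 0 i))
    (hzstar : F zstar ≤ F0)
    (hTlarge : (4 * (F0 - F zstar) / (γ ^ 2 * ρ)) *
        ((1 + (Finset.Icc 1 T).sup' (Finset.nonempty_Icc.mpr hT) ε) /
         (1 - (Finset.Icc 1 T).sup' (Finset.nonempty_Icc.mpr hT) (fun t => π t ^ 2))) ≤
        (T : ℝ)) :
    (1 / (m : ℝ)) * ∑ i, F (e T i) ≤ F zstar := by
  have hm0 : (0 : ℝ) < m := by exact_mod_cast hm
  set E := (Finset.Icc 1 T).sup' (Finset.nonempty_Icc.mpr hT) ε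
  set P := (Finset.Icc 1 T).sup' (Finset.nonempty_Icc.mpr hT) (fun t => π t ^ 2) with hPdef
  have hεE : ∀ t ∈ Finset.Icc 1 T, ε t ≤ E := fun t ht => Finset.le_sup' ε ht
  have hπP : ∀ t ∈ Finset.Icc 1 T, π t ^ 2 ≤ P :=
    fun t ht => Finset.le_sup' (fun t => π t ^ 2) ht
  have hP1 : P < 1 := by
    rw [hPdef, Finset.sup'_lt_iff]
    intro t ht
    have := hπ t ht
    nlinarith
  have hE0 : 0 < E := (hε 1 (by simp [hT])).trans_le (hεE 1 (by simp [hT]))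
  set δ := γ ^ 2 * ρ * (1 - P) / (4 * (1 + E)) with hδ
  have hstep : ∀ t ∈ Finset.Icc 1 T, (1 / (m : ℝ)) * ∑ i, F (e t i)
      ≤ (1 / (m : ℝ)) * ∑ i, F (e (t - 1) i) - δ := by
    intro t ht
    have htT : t - 1 < T := by
      have := Finset.mem_Icc.mp ht
      omega
    have hεt := hε t ht
    have hW2t := hW2pos t ht
    have hMt : 0 < M t := by
      obtain ⟨i, hi⟩ := (hM t ht).2
      rw [← hi]
      exact abs_pos.mpr (hb t ht i)
    set q := ε t * α t ^ 2 * M t ^ 2 * W2 t with hq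
    have hi : ∀ i, F (e t i) ≤ F (e (t - 1) i) + q
        + α t ^ 2 * M t ^ 2 * (vderiv2 F (α t * b t i) (v (t - 1) i) (e (t - 1) i)
          * (b t i / M t) ^ 2) - α t * (w t i * b t i) := by
      intro i
      have hQi := hQ t ht i
      rw [he t ht i] at hQi
      have h := sub_le_of_OBI_le (mul_ne_zero (hα t ht) (hb t ht i)) (hv _ htT i) hQi
      have h2 : α t ^ 2 * M t ^ 2 * (vderiv2 F (α t * b t i) (v (t - 1) i) (e (t - 1) i)
          * (b t i / M t) ^ 2) = (α t * b t i) ^ 2 *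
            vderiv2 F (α t * b t i) (v (t - 1) i) (e (t - 1) i) := by
        field_simp
      rw [h2, he t ht i, hw t ht i]
      linarith
    have hsum := Finset.sum_le_sum fun i (_ : i ∈ Finset.univ) => hi i
    simp only [Finset.sum_add_distrib, Finset.sum_sub_distrib, ← Finset.mul_sum,
      Finset.sum_const, Finset.card_univ, Fintype.card_fin, nsmul_eq_mul] at hsum
    have hmean := mul_le_mul_of_nonneg_left hsum (one_div_nonneg.mpr hm0.le)
    have hcurv := mul_le_mul_of_nonneg_left (hW2 t ht)
      (by positivity : 0 ≤ α t ^ 2 * M t ^ 2)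
    have hmq : 1 / (m : ℝ) * (m * q) = q := by field_simp
    set K := (1 + ε t) * M t ^ 2 * W2 t with hK
    have hK0 : 0 < K := by positivity
    have hαt := hαmem t ht
    rw [show 2 * (1 + ε t) * M t ^ 2 * W2 t = 2 * K by rw [hK]; ring] at hαt
    have hquad := quadratic_step_le hK0 (hπ t ht).1 hαt
    have hWt := hWpos t ht
    have hηeq : η t = ηnorm t * M t * (W t / m) := by
      rw [hη t ht, hηnorm t ht]
      field_simp
    have hW1le : W1 t ≤ W t / m := by
      rw [hW1 t ht, hW t ht, abs_mul, abs_of_pos (by positivity), one_div, div_eq_inv_mul]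
      gcongr
      exact Finset.abs_sum_le_sum_abs _ _
    have hW10 : 0 ≤ W1 t := by
      rw [hW1 t ht]
      exact abs_nonneg _
    have hηlb : (γ * M t * W1 t) ^ 2 ≤ η t ^ 2 := by
      rw [← sq_abs (η t), hηeq, abs_mul, abs_mul, abs_of_pos hMt,
        abs_of_pos (by positivity : 0 < W t / m)]
      have := hWLA t ht
      gcongr
    have hρt : ρ * W2 t < W1 t ^ 2 := (lt_div_iff₀ hW2t).mp (hWRA t ht)
    have hηK : γ ^ 2 * ρ / (4 * (1 + ε t)) ≤ η t ^ 2 / (4 * K) := by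
      rw [div_le_div_iff₀ (by positivity) (by positivity)]
      calc γ ^ 2 * ρ * (4 * K) = 4 * (1 + ε t) * (γ ^ 2 * M t ^ 2 * (ρ * W2 t)) := by
            rw [hK]; ring
        _ ≤ 4 * (1 + ε t) * (γ ^ 2 * M t ^ 2 * W1 t ^ 2) := by gcongr
        _ = (γ * M t * W1 t) ^ 2 * (4 * (1 + ε t)) := by ring
        _ ≤ η t ^ 2 * (4 * (1 + ε t)) := by gcongr
    have hδle : δ ≤ η t ^ 2 / (4 * K) * (1 - π t ^ 2) := by
      have h1 : γ ^ 2 * ρ / (4 * (1 + E)) ≤ γ ^ 2 * ρ / (4 * (1 + ε t)) := by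
        have := hεE t ht
        gcongr
      have h2 : 1 - P ≤ 1 - π t ^ 2 := by linarith [hπP t ht]
      rw [hδ, mul_div_right_comm]
      exact mul_le_mul (h1.trans hηK) h2 (by linarith) (by positivity)
    have hηt := hη t ht
    have hqK : q + α t ^ 2 * M t ^ 2 * W2 t = K * α t ^ 2 := by rw [hq, hK]; ring
    have hαη : α t * η t = α t * ((1 / (m : ℝ)) * ∑ i, w t i * b t i) := by rw [hηt]
    linarith
  have hind : ∀ t ≤ T, (1 / (m : ℝ)) * ∑ i, F (e t i) ≤ F0 - t * δ := by
    intro t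
    induction t with
    | zero => intro _; simp [hF0]
    | succ t ih =>
      intro ht
      have h := hstep (t + 1) (Finset.mem_Icc.mpr ⟨by omega, ht⟩)
      rw [Nat.add_sub_cancel] at h
      push_cast
      linarith [ih (by omega)]
  have hP0 : 0 < 1 - P := by linarith
  have hδ0 : 0 < δ := by positivity
  have hfin : F0 - F zstar ≤ T * δ := by
    have h := mul_le_mul_of_nonneg_right hTlarge hδ0.le
    have hcancel : 4 * (F0 - F zstar) / (γ ^ 2 * ρ) * ((1 + E) / (1 - P)) * δ
        = F0 - F zstar := by
      rw [hδ]
      field_simp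
    linarith
  linarith [hind T le_rfl]
end
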